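/- (High-momentum cutoff function) There exist a constant M₀ > 0 such that for every M ≥ M₀ there is a smooth compactly supported function φ : ℝ³ → ℝ whose support is contained in the closed ball of radius e^{M²} centered at the origin, and whose Fourier transform φ̂ satisfies: |φ̂(p) − 1| ≤ e^{−M²} for all p with |p| ≤ M, and |φ̂(p)| ≤ e^{−M²} for all p with |p| ≥ 2M. -/

import Mathlib

open scoped FourierTransform

/-- A real-valued Schwartz function whose Fourier transform is a cutoff. -/
lemma exists_base_cutoff :
    ∃ h : SchwartzMap (EuclideanSpace ℝ (Fin 3)) ℂ, (∀ y, ((h y).re : ℂ) = h y) ∧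
      (∀ q, ‖q‖ ≤ 1 → 𝓕 (fun y => h y) q = 1) ∧ (∀ q, 2 ≤ ‖q‖ → 𝓕 (fun y => h y) q = 0) := by
  let χ : ContDiffBump (0 : EuclideanSpace ℝ (Fin 3)) := ⟨1, 2, by norm_num, by norm_num⟩
  have hc : HasCompactSupport (fun x => (χ x : ℂ)) :=
    χ.hasCompactSupport.comp_left (g := fun t : ℝ => (t : ℂ)) (by simp)
  have hd : ContDiff ℝ (⊤ : ℕ∞) (fun x => (χ x : ℂ)) :=
    Complex.ofRealCLM.contDiff.comp χ.contDiff
  let X : SchwartzMap (EuclideanSpace ℝ (Fin 3)) ℂ := hc.toSchwartzMap hd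
  have hX : ∀ x, X x = (χ x : ℂ) := fun x => rfl
  let G : SchwartzMap (EuclideanSpace ℝ (Fin 3)) ℂ := 𝓕⁻ X
  have hF : 𝓕 (fun y => G y) = fun x => (χ x : ℂ) := by
    have h1 : 𝓕 G = X := FourierTransform.fourier_fourierInv_eq X
    have h2 := SchwartzMap.fourier_coe G
    rw [h1] at h2
    rw [show (fun y => G y) = ⇑G from rfl, ← h2]
    rfl
  refine ⟨G, fun y => ?_, fun q hq => ?_, fun q hq => ?_⟩
  · rw [← Complex.conj_eq_iff_re]
    rw [show (G y) = 𝓕⁻ (X : EuclideanSpace ℝ (Fin 3) → ℂ) y by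
      rw [← SchwartzMap.fourierInv_coe]]
    have e : (fun x => X (-x)) = X := by
      ext x; rw [hX, hX, χ.neg]
    conv_rhs => rw [Real.fourierInv_eq_fourier_comp_neg, e]
    rw [Real.fourierInv_eq', Real.fourier_eq', ← integral_conj]
    congr 1
    ext v
    rw [hX, smul_eq_mul, smul_eq_mul, map_mul, Complex.conj_ofReal, ← Complex.exp_conj, map_mul,
      Complex.conj_ofReal, Complex.conj_I]
    congr 2
    push_cast
    ring
  · rw [hF]
    have : χ q = 1 := χ.one_of_mem_closedBall (by simpa using hq)
    simp [this]
  · rw [hF]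
    have : χ q = 0 := χ.zero_of_le_dist (by simpa using hq)
    simp [this]

open MeasureTheory in
lemma fourier_scale (ψ : EuclideanSpace ℝ (Fin 3) → ℂ) (M : ℝ) (hM : 0 < M)
    (p : EuclideanSpace ℝ (Fin 3)) :
    𝓕 (fun x => (M : ℂ) ^ 3 * ψ (M • x)) p = 𝓕 ψ (M⁻¹ • p) := by
  rw [Real.fourier_eq', Real.fourier_eq']
  have := Measure.integral_comp_smul (volume : Measure (EuclideanSpace ℝ (Fin 3)))
    (fun y => (M : ℂ) ^ 3 * (Complex.exp (((-2 * Real.pi * inner ℝ y (M⁻¹ • p) : ℝ) : ℂ)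
      * Complex.I) • ψ y)) M
  have hM' : (M : ℂ) ≠ 0 := by exact_mod_cast hM.ne'
  calc _ = ∫ v, (M : ℂ) ^ 3 * (Complex.exp (((-2 * Real.pi *
          inner ℝ (M • v) (M⁻¹ • p) : ℝ) : ℂ) * Complex.I) • ψ (M • v)) := by
        refine integral_congr_ae (Filter.Eventually.of_forall fun v => ?_)
        simp only [inner_smul_left, inner_smul_right, smul_eq_mul]
        rw [show M⁻¹ * ((starRingEnd ℝ) M * inner ℝ v p) = inner ℝ v p by simp [hM.ne']]
        ring
    _ = _ := this
    _ = _ := by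
        simp only [finrank_euclideanSpace, Fintype.card_fin, abs_of_pos (inv_pos.2 (pow_pos hM 3)),
          Complex.real_smul, Complex.ofReal_inv, Complex.ofReal_pow]
        rw [integral_const_mul, inv_mul_cancel_left₀ (pow_ne_zero 3 hM')]

open MeasureTheory in
lemma fourier_trunc (h : SchwartzMap (EuclideanSpace ℝ (Fin 3)) ℂ)
    (η : EuclideanSpace ℝ (Fin 3) → ℝ) (hη : Continuous η) (S : ℝ) (hS : 0 < S)
    (h0 : ∀ y, 0 ≤ η y) (h1 : ∀ y, η y ≤ 1) (hin : ∀ y, ‖y‖ ≤ S / 2 → η y = 1)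
    (q : EuclideanSpace ℝ (Fin 3)) :
    ‖𝓕 (fun y => (η y : ℂ) * h y) q - 𝓕 (fun y => h y) q‖ ≤ 2 / S * ∫ y, ‖y‖ ^ 1 * ‖h y‖ := by
  have hi : Integrable (fun y => h y) := h.integrable
  have hi2 : Integrable (fun y => (η y : ℂ) * h y) := by
    refine hi.mono (by fun_prop) (Filter.Eventually.of_forall fun y => ?_)
    rw [norm_mul, Complex.norm_real, Real.norm_eq_abs, abs_of_nonneg (h0 y)]
    exact mul_le_of_le_one_left (norm_nonneg _) (h1 y)
  rw [Real.fourier_eq, Real.fourier_eq, ← integral_sub, ← integral_const_mul]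
  · refine norm_integral_le_of_norm_le ((h.integrable_pow_mul volume 1).const_mul _)
      (Filter.Eventually.of_forall fun y => ?_)
    rw [← smul_sub, Circle.norm_smul, ← sub_one_mul, norm_mul, ← mul_assoc]
    refine mul_le_mul_of_nonneg_right ?_ (norm_nonneg _)
    rw [← Complex.ofReal_one, ← Complex.ofReal_sub, Complex.norm_real, Real.norm_eq_abs]
    by_cases hy : ‖y‖ ≤ S / 2
    · rw [hin y hy]; simp; positivity
    · push Not at hy
      have : |η y - 1| ≤ 1 := by rw [abs_le]; constructor <;> linarith [h0 y, h1 y]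
      refine this.trans ?_
      rw [pow_one, div_mul_eq_mul_div, le_div_iff₀ hS]
      linarith
  · exact (Real.fourierIntegral_convergent_iff q).2 hi2
  · exact (Real.fourierIntegral_convergent_iff q).2 hi

/-- **Existence of a high-momentum cutoff function.**
There is `M₀ > 0` such that for every `M ≥ M₀` there is a smooth, compactly supported
`φ : ℝ³ → ℝ` with support contained in the closed ball of radius `e^{M²}`, whose Fourier
transform `φ̂` satisfies `|φ̂(p) − 1| ≤ e^{−M²}` for `|p| ≤ M` and `|φ̂(p)| ≤ e^{−M²}`
for `|p| ≥ 2M`. -/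
theorem exists_high_momentum_cutoff :
    ∃ M₀ : ℝ, 0 < M₀ ∧ ∀ M : ℝ, M₀ ≤ M →
      ∃ φ : EuclideanSpace ℝ (Fin 3) → ℝ,
        ContDiff ℝ (⊤ : ℕ∞) φ ∧
        HasCompactSupport φ ∧
        tsupport φ ⊆ Metric.closedBall 0 (Real.exp (M ^ 2)) ∧
        (∀ p : EuclideanSpace ℝ (Fin 3), ‖p‖ ≤ M →
          ‖𝓕 (fun x => (φ x : ℂ)) p - 1‖ ≤ Real.exp (-M ^ 2)) ∧
        (∀ p : EuclideanSpace ℝ (Fin 3), 2 * M ≤ ‖p‖ →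
          ‖𝓕 (fun x => (φ x : ℂ)) p‖ ≤ Real.exp (-M ^ 2)) := by
  obtain ⟨h, hre, hone, hzero⟩ := exists_base_cutoff
  set C : ℝ := ∫ y, ‖y‖ ^ 1 * ‖h y‖ with hC
  have hC0 : 0 ≤ C := MeasureTheory.integral_nonneg fun y => by positivity
  refine ⟨2 * C + 1, by positivity, fun M hM => ?_⟩
  have hM0 : 0 < M := by linarith
  set R := Real.exp (M ^ 2) with hR
  have hR0 : 0 < R := Real.exp_pos _
  have hS : 0 < M * R := by positivity
  let η : ContDiffBump (0 : EuclideanSpace ℝ (Fin 3)) :=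
    ⟨M * R / 2, M * R, by positivity, by linarith⟩
  let φ : EuclideanSpace ℝ (Fin 3) → ℝ := fun x => M ^ 3 * (η (M • x) * (h (M • x)).re)
  have hsub : tsupport φ ⊆ Metric.closedBall 0 R := by
    refine closure_minimal (fun x hx => ?_) Metric.isClosed_closedBall
    by_contra hxR
    apply hx
    have hxR : R < ‖x‖ := by simpa using hxR
    have : η (M • x) = 0 := η.zero_of_le_dist (by
      rw [dist_zero_right, norm_smul, Real.norm_eq_abs, abs_of_pos hM0]
      exact mul_le_mul_of_nonneg_left hxR.le hM0.le)
    simp [φ, this]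
  have key : ∀ p, ‖𝓕 (fun x => (φ x : ℂ)) p - 𝓕 (fun y => h y) (M⁻¹ • p)‖ ≤
      Real.exp (-M ^ 2) := by
    intro p
    have e : (fun x => (φ x : ℂ)) =
        fun x => (M : ℂ) ^ 3 * (fun y => (η y : ℂ) * h y) (M • x) := by
      ext x
      simp only [φ]
      push_cast
      rw [hre]
    rw [e, fourier_scale (fun y => (η y : ℂ) * h y) M hM0]
    refine (fourier_trunc h η η.continuous (M * R) hS (fun y => η.nonneg) (fun y => η.le_one)
      (fun y hy => η.one_of_mem_closedBall (by simpa using hy)) _).trans ?_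
    rw [← hC, Real.exp_neg, ← hR, div_mul_eq_mul_div, div_le_iff₀ hS]
    have : R⁻¹ * (M * R) = M := by field_simp
    rw [this]
    linarith
  have hn : ∀ p : EuclideanSpace ℝ (Fin 3), ‖M⁻¹ • p‖ = ‖p‖ / M := fun p => by
    rw [norm_smul, Real.norm_eq_abs, abs_of_pos (inv_pos.2 hM0), div_eq_inv_mul]
  refine ⟨φ, ?_, (isCompact_closedBall _ _).of_isClosed_subset (isClosed_tsupport _) hsub, hsub,
    fun p hp => ?_, fun p hp => ?_⟩
  · have hs : ContDiff ℝ (⊤ : ℕ∞) (fun x : EuclideanSpace ℝ (Fin 3) => M • x) :=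
      contDiff_id.const_smul M
    have h1 : ContDiff ℝ (⊤ : ℕ∞) (fun x => η (M • x)) := η.contDiff.comp hs
    have h2 : ContDiff ℝ (⊤ : ℕ∞) (fun x => (h (M • x)).re) :=
      Complex.reCLM.contDiff.comp ((h.smooth ⊤).comp hs)
    exact contDiff_const.mul (h1.mul h2)
  · have := key p
    rwa [hone _ (by rw [hn, div_le_one hM0]; exact hp)] at this
  · have := key p
    rwa [hzero _ (by rw [hn, le_div_iff₀ hM0]; exact hp), sub_zero] at this
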